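/- For all x, y ∈ X and i, j ∈ Bool, the modified evolution converges as t → ∞ as follows: if C(x) = C(y), then E'_t(|x⟩⟨y| ⊗ |i⟩⟨j|) → δ_{i,j} · |x⟩⟨y| ⊗ |C(x)⟩⟨C(y)|; if C(x) ≠ C(y), then E'_t(|x⟩⟨y| ⊗ |i⟩⟨j|) → δ_{i, ¬j} · |x⟩⟨y| ⊗ |C(x)⟩⟨C(y)|, where δ denotes the Kronecker delta on Bool. -/

import Mathlib

open Matrix Filter
open scoped Kronecker Topology

attribute [local instance] Matrix.normedAddCommGroup Matrix.normedSpace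

noncomputable section

/-- The computational basis of `n` qubits, `X = {0,1}ⁿ`. -/
abbrev QubitBasis (n : ℕ) := Fin n → Bool

/-- Evaluation of the 3-literal clause with indices `i₁ i₂ i₃` and bits `b₁ b₂ b₃`:
`C(x) = ¬(x i₁ = b₁ ∧ x i₂ = b₂ ∧ x i₃ = b₃)`. -/
def clauseEval {n : ℕ} (i₁ i₂ i₃ : Fin n) (b₁ b₂ b₃ : Bool) (x : QubitBasis n) : Bool :=
  ! (decide (x i₁ = b₁) && decide (x i₂ = b₂) && decide (x i₃ = b₃))

/-- The modified Lindblad operator `L' = Π⁻ ⊗ σ⁻ + (I − Π⁻) ⊗ σ⁺`: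
`L'((x,a),(y,b)) = 1` iff `x = y`, `a = C(x)` and `b = ¬C(x)`. -/
def jumpOp' {n : ℕ} (C : QubitBasis n → Bool) :
    Matrix (QubitBasis n × Bool) (QubitBasis n × Bool) ℂ :=
  Matrix.of fun p q =>
    if p.1 = q.1 ∧ p.2 = C p.1 ∧ q.2 = !C p.1 then 1 else 0

/-- The Lindbladian `ℒ(ρ) = γ (L ρ L† − (1/2)(L†L ρ + ρ L†L))` as a linear endomorphism
of the matrix space. -/
def lindbladian {d : Type*} [Fintype d] [DecidableEq d] (γ : ℝ) (L : Matrix d d ℂ) :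
    Matrix d d ℂ →ₗ[ℂ] Matrix d d ℂ :=
  (γ : ℂ) • ((LinearMap.mulRight ℂ Lᴴ).comp (LinearMap.mulLeft ℂ L)
    - (1 / 2 : ℂ) • (LinearMap.mulLeft ℂ (Lᴴ * L) + LinearMap.mulRight ℂ (Lᴴ * L)))

/-- The evolution `E'_t = exp(t·ℒ')`, the exponential of the endomorphism `ℒ'`. -/
def evol {d : Type*} [Fintype d] [DecidableEq d]
    (L : Matrix d d ℂ →ₗ[ℂ] Matrix d d ℂ) (t : ℝ) :
    Matrix d d ℂ →L[ℂ] Matrix d d ℂ :=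
  haveI : IsTopologicalRing (Matrix d d ℂ →L[ℂ] Matrix d d ℂ) := by
    have h (E : Type _) [NormedAddCommGroup E] [NormedSpace ℂ E] :
        IsTopologicalRing (E →L[ℂ] E) := inferInstance
    exact h (Matrix d d ℂ)
  NormedSpace.exp ((t : ℂ) • LinearMap.toContinuousLinearMap L)

/-- The Kronecker delta on `Bool`, valued in `ℂ`. -/
def kdelta (i j : Bool) : ℂ := if i = j then 1 else 0

theorem clm_exp_eigen {E : Type*} [NormedAddCommGroup E] [NormedSpace ℂ E] [CompleteSpace E]
    (T : E →L[ℂ] E) (v : E) (c : ℂ) (h : T v = c • v) :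
    NormedSpace.exp T v = Complex.exp c • v := by
  have hp : ∀ k : ℕ, (T ^ k) v = c ^ k • v := by
    intro k
    induction k with
    | zero => simp
    | succ k ih =>
      rw [pow_succ, mul_apply_eq_comp, h, map_smul, ih, smul_smul, pow_succ, mul_comm]
  have h1 := (NormedSpace.exp_series_hasSum_exp' (𝕂 := ℂ) T).mapL
    (ContinuousLinearMap.apply ℂ E v)
  have h2 := (NormedSpace.exp_series_hasSum_exp' (𝕂 := ℂ) c).smul_const v
  rw [← Complex.exp_eq_exp_ℂ] at h2
  refine h1.unique ?_
  convert h2 using 2 with k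
  simp [hp, smul_smul]

theorem evol_eigen {d : Type*} [Fintype d] [DecidableEq d]
    (L : Matrix d d ℂ →ₗ[ℂ] Matrix d d ℂ) (t : ℝ) (v : Matrix d d ℂ) (c : ℂ)
    (h : L v = c • v) : evol L t v = Complex.exp (t * c) • v := by
  refine clm_exp_eigen (E := Matrix d d ℂ) ((t : ℂ) • LinearMap.toContinuousLinearMap L) v _ ?_
  change (t : ℂ) • L v = _
  rw [h, smul_smul]

theorem jump_mul_single {n : ℕ} (C : QubitBasis n → Bool) (x : QubitBasis n) (i : Bool)
    (q : QubitBasis n × Bool) :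
    jumpOp' C * single (x, i) q 1 = if i = !C x then single (x, C x) q 1 else 0 := by
  ext ⟨a, b⟩ r
  by_cases hr : r = q
  · subst hr
    rw [mul_single_apply_same]
    simp only [jumpOp', of_apply]
    by_cases ha : a = x
    · subst ha
      split_ifs <;> simp_all [single_apply, eq_comm]
    · split_ifs <;> simp_all [single_apply, eq_comm]
  · rw [mul_single_apply_of_ne _ _ _ _ _ hr]
    split_ifs <;> simp [single_apply, Ne.symm hr]

theorem jumpH_mul_single {n : ℕ} (C : QubitBasis n → Bool) (x : QubitBasis n) (i : Bool)
    (q : QubitBasis n × Bool) :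
    (jumpOp' C)ᴴ * single (x, i) q 1 = if i = C x then single (x, !C x) q 1 else 0 := by
  ext ⟨a, b⟩ r
  by_cases hr : r = q
  · subst hr
    rw [mul_single_apply_same]
    simp only [jumpOp', of_apply, conjTranspose_apply]
    by_cases ha : a = x
    · subst ha
      split_ifs <;> simp_all [single_apply, eq_comm]
    · split_ifs <;> simp_all [single_apply, eq_comm]
  · rw [mul_single_apply_of_ne _ _ _ _ _ hr]
    split_ifs <;> simp [single_apply, Ne.symm hr]

theorem single_mul_jumpH {n : ℕ} (C : QubitBasis n → Bool) (x : QubitBasis n) (i : Bool)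
    (q : QubitBasis n × Bool) :
    single q (x, i) 1 * (jumpOp' C)ᴴ = if i = !C x then single q (x, C x) 1 else 0 := by
  have h := congrArg conjTranspose (jump_mul_single C x i q)
  rw [conjTranspose_mul, conjTranspose_single, star_one] at h
  rw [h]
  split_ifs <;> simp

theorem single_mul_jump {n : ℕ} (C : QubitBasis n → Bool) (x : QubitBasis n) (i : Bool)
    (q : QubitBasis n × Bool) :
    single q (x, i) 1 * jumpOp' C = if i = C x then single q (x, !C x) 1 else 0 := by
  have h := congrArg conjTranspose (jumpH_mul_single C x i q)
  rw [conjTranspose_mul, conjTranspose_single, star_one, conjTranspose_conjTranspose] at h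
  rw [h]
  split_ifs <;> simp

theorem lind_single {n : ℕ} (C : QubitBasis n → Bool) (γ : ℝ) (x y : QubitBasis n) (i j : Bool) :
    lindbladian γ (jumpOp' C) (single (x, i) (y, j) 1) =
      (γ : ℂ) • ((if i = !C x then (if j = !C y then single (x, C x) (y, C y) 1 else 0) else 0)
        - (1 / 2 : ℂ) • ((if i = !C x then single (x, i) (y, j) 1 else 0)
          + (if j = !C y then single (x, i) (y, j) 1 else 0))) := by
  have e : lindbladian γ (jumpOp' C) (single (x, i) (y, j) 1) =
      (γ : ℂ) • (jumpOp' C * single (x, i) (y, j) 1 * (jumpOp' C)ᴴ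
        - (1 / 2 : ℂ) • ((jumpOp' C)ᴴ * (jumpOp' C * single (x, i) (y, j) 1)
          + single (x, i) (y, j) 1 * (jumpOp' C)ᴴ * jumpOp' C)) := by
    rw [← Matrix.mul_assoc, Matrix.mul_assoc _ (jumpOp' C)ᴴ (jumpOp' C)]
    rfl
  rw [e, jump_mul_single, single_mul_jumpH]
  by_cases hi : i = !C x <;> by_cases hj : j = !C y <;>
    simp [hi, hj, single_mul_jumpH, single_mul_jump, jumpH_mul_single]

theorem tendsto_decay {E : Type*} [NormedAddCommGroup E] [NormedSpace ℂ E] (v w : E) (r : ℝ)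
    (hr : r < 0) :
    Tendsto (fun t : ℝ => Complex.exp ((t : ℂ) * (r : ℂ)) • v + w) atTop (𝓝 w) := by
  have h : Tendsto (fun t : ℝ => Complex.exp ((t : ℂ) * (r : ℂ))) atTop (𝓝 0) := by
    have := Real.tendsto_exp_atBot.comp (tendsto_id.atTop_mul_const_of_neg hr)
    have h2 := (Complex.continuous_ofReal.tendsto 0).comp this
    simpa [Function.comp_def] using h2
  simpa using (h.smul_const v).add_const w

theorem tendsto_decay_mat {d : Type*} [Fintype d] (v w : Matrix d d ℂ) (r : ℝ) (hr : r < 0) :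
    Tendsto (fun t : ℝ => Complex.exp ((t : ℂ) * (r : ℂ)) • v + w) atTop (𝓝 w) := by
  exact tendsto_decay (E := Matrix d d ℂ) v w r hr

theorem evol_limit_general {n : ℕ} (C : QubitBasis n → Bool) (γ : ℝ) (hγ : 0 < γ)
    (x y : QubitBasis n) (i j : Bool) :
    Tendsto
      (fun t : ℝ => evol (lindbladian γ (jumpOp' C)) t (single (x, i) (y, j) 1)) atTop
      (𝓝 ((if (i = C x ↔ j = C y) then (1 : ℂ) else 0) • single (x, C x) (y, C y) (1 : ℂ))) := by
  have hB : lindbladian γ (jumpOp' C) (single (x, C x) (y, C y) 1)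
      = (0 : ℂ) • single (x, C x) (y, C y) 1 := by
    rw [lind_single]; simp
  by_cases hi : i = C x <;> by_cases hj : j = C y
  · subst hi hj
    simp [evol_eigen _ _ _ _ hB]
  · have hj' : j = !C y := by simpa using Bool.eq_not_of_ne hj
    have hA : lindbladian γ (jumpOp' C) (single (x, i) (y, j) 1)
        = ((-(γ / 2) : ℝ) : ℂ) • single (x, i) (y, j) 1 := by
      rw [lind_single]
      subst hi hj'
      simp only [Bool.eq_not_self, if_false, if_true]
      push_cast
      module
    simp only [evol_eigen _ _ _ _ hA]
    simpa [hi, hj] using tendsto_decay_mat (single (x, i) (y, j) (1 : ℂ)) 0 (-(γ / 2)) (by linarith)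
  · have hi' : i = !C x := by simpa using Bool.eq_not_of_ne hi
    have hA : lindbladian γ (jumpOp' C) (single (x, i) (y, j) 1)
        = ((-(γ / 2) : ℝ) : ℂ) • single (x, i) (y, j) 1 := by
      rw [lind_single]
      subst hj hi'
      simp only [Bool.eq_not_self, if_false, if_true]
      push_cast
      module
    simp only [evol_eigen _ _ _ _ hA]
    simpa [hi, hj] using tendsto_decay_mat (single (x, i) (y, j) (1 : ℂ)) 0 (-(γ / 2)) (by linarith)
  · have hi' : i = !C x := by simpa using Bool.eq_not_of_ne hi
    have hj' : j = !C y := by simpa using Bool.eq_not_of_ne hj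
    have hA : lindbladian γ (jumpOp' C)
          (single (x, i) (y, j) 1 - single (x, C x) (y, C y) 1)
        = ((-γ : ℝ) : ℂ) • (single (x, i) (y, j) 1 - single (x, C x) (y, C y) 1) := by
      rw [map_sub, hB, lind_single]
      subst hi' hj'
      simp only [if_true]
      push_cast
      module
    have key : ∀ t : ℝ, evol (lindbladian γ (jumpOp' C)) t (single (x, i) (y, j) 1) =
        Complex.exp ((t : ℂ) * ((-γ : ℝ) : ℂ)) •
          (single (x, i) (y, j) 1 - single (x, C x) (y, C y) 1)
          + single (x, C x) (y, C y) 1 := by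
      intro t
      have h1 := evol_eigen _ t _ _ hA
      have h2 := evol_eigen _ t _ _ hB
      rw [map_sub, h2] at h1
      rw [← h1]
      simp
    simp only [key]
    simpa [hi, hj] using tendsto_decay_mat
      (single (x, i) (y, j) (1 : ℂ) - single (x, C x) (y, C y) 1)
      (single (x, C x) (y, C y) 1) (-γ) (by linarith)

/-- limits of the modified evolution on matrix elements:
`E'_t(|x⟩⟨y| ⊗ |i⟩⟨j|) → δ_{i,j}·|x⟩⟨y| ⊗ |C(x)⟩⟨C(y)|` when `C(x) = C(y)`, and
`E'_t(|x⟩⟨y| ⊗ |i⟩⟨j|) → δ_{i,¬j}·|x⟩⟨y| ⊗ |C(x)⟩⟨C(y)|` when `C(x) ≠ C(y)`. -/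
theorem evol'_matrix_unit_limit {n : ℕ} (hn : 1 ≤ n)
    (i₁ i₂ i₃ : Fin n) (h₁₂ : i₁ ≠ i₂) (h₁₃ : i₁ ≠ i₃) (h₂₃ : i₂ ≠ i₃)
    (b₁ b₂ b₃ : Bool) (γ : ℝ) (hγ : 0 < γ)
    (C : QubitBasis n → Bool) (hC : C = clauseEval i₁ i₂ i₃ b₁ b₂ b₃)
    (x y : QubitBasis n) (i j : Bool) :
    (C x = C y →
      Tendsto
        (fun t : ℝ => evol (lindbladian γ (jumpOp' C)) t (single (x, i) (y, j) 1))
        atTop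
        (𝓝 (kdelta i j • single (x, C x) (y, C y) (1 : ℂ)))) ∧
    (C x ≠ C y →
      Tendsto
        (fun t : ℝ => evol (lindbladian γ (jumpOp' C)) t (single (x, i) (y, j) 1))
        atTop
        (𝓝 (kdelta i (!j) • single (x, C x) (y, C y) (1 : ℂ)))) := by
  have h := evol_limit_general C γ hγ x y i j
  refine ⟨fun hc => ?_, fun hc => ?_⟩
  · have e : kdelta i j = if (i = C x ↔ j = C y) then (1 : ℂ) else 0 := by
      rw [kdelta, hc]
      generalize C y = b
      cases i <;> cases j <;> cases b <;> simp
    rw [e]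
    exact h
  · have e : kdelta i (!j) = if (i = C x ↔ j = C y) then (1 : ℂ) else 0 := by
      rw [kdelta, Bool.eq_not_of_ne hc]
      generalize C y = b
      cases i <;> cases j <;> cases b <;> simp
    rw [e]
    exact h
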